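/- There is no positive integer d such that 2d + 1, 13d + 1 and 26d + 1 are simultaneously perfect cubes; that is, there are no positive integers d, u, v, w with 2d + 1 = u^3, 13d + 1 = v^3 and 26d + 1 = w^3. -/

import Mathlib

/-- Odd divisors of `k ^ 2 + 3` are represented by `s ^ 2 + 3 t ^ 2`, compatibly with `k`. -/
lemma form_repr (n : ℕ) : ∀ m : ℤ, 0 < m → m < n → Odd m → ∀ k : ℤ, m ∣ k ^ 2 + 3 →
    ∃ s t : ℤ, m = s ^ 2 + 3 * t ^ 2 ∧ m ∣ s - k * t := by
  induction n with
  | zero => intro m h1 h2; simp at h2; omega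
  | succ n ih =>
    intro m hm hmn hodd k hk
    by_cases h1 : m = 1
    · exact ⟨1, 0, by simp [h1], by simp [h1]⟩
    have hm3 : 3 ≤ m := by obtain ⟨j, rfl⟩ := hodd; omega
    obtain ⟨k0, hk0, hlo, hhi, c, hc⟩ :
        ∃ k0 : ℤ, Even k0 ∧ -m < k0 ∧ k0 < m ∧ m ∣ k - k0 := by
      have e := Int.emod_add_mul_ediv k m
      have l := Int.emod_nonneg k hm.ne'
      have u := Int.emod_lt_of_pos k hm
      rcases Int.even_or_odd (k % m) with he | ho
      · exact ⟨k % m, he, by omega, u, ⟨k / m, by linarith⟩⟩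
      · refine ⟨k % m - m, ho.sub_odd hodd, ?_, by omega, ⟨k / m + 1, by linarith⟩⟩
        have : k % m ≠ 0 := by intro h; rw [h] at ho; simp at ho
        omega
    have hk' : m ∣ k0 ^ 2 + 3 := by
      have : k0 ^ 2 + 3 = (k ^ 2 + 3) - m * (c * (k + k0)) := by
        linear_combination (-(k + k0)) * hc
      rw [this]
      exact dvd_sub hk (dvd_mul_right _ _)
    obtain ⟨m', hm'⟩ := hk'
    have hm'pos : 0 < m' := by
      by_contra h
      nlinarith [sq_nonneg k0]
    have hm'lt : m' < m := by
      by_contra h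
      nlinarith
    have hm'odd : Odd m' := by
      have : Odd (k0 ^ 2 + 3) := by
        have h2 : Even (k0 ^ 2) := by rw [Int.even_pow]; exact ⟨hk0, by norm_num⟩
        exact h2.add_odd (by decide)
      rw [hm', Int.odd_mul] at this
      exact this.2
    obtain ⟨s, t, hst, T, hT⟩ := ih m' hm'pos (by push_cast at hmn; omega) hm'odd k0
      ⟨m, by linarith⟩
    have hS : k0 * s + 3 * t = m' * (k0 * T + m * t) := by
      linear_combination k0 * hT + t * hm'
    refine ⟨k0 * T + m * t, T, ?_, ?_⟩
    · have : m' ^ 2 * m = m' ^ 2 * ((k0 * T + m * t) ^ 2 + 3 * T ^ 2) := by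
        have e1 : m' ^ 2 * ((k0 * T + m * t) ^ 2 + 3 * T ^ 2)
            = (k0 * s + 3 * t) ^ 2 + 3 * (s - k0 * t) ^ 2 := by
          rw [hS, hT]; ring
        rw [e1]
        linear_combination (-(s ^ 2 + 3 * t ^ 2)) * hm' + m * m' * hst
      exact mul_left_cancel₀ (by positivity) this
    · refine ⟨t - c * T, ?_⟩
      linear_combination (-T) * hc

/-- Dividing `a + b √-3` by `s + t √-3`. -/
lemma form_div {m s t k a b N : ℤ} (hm : 0 < m) (hst : m = s ^ 2 + 3 * t ^ 2)
    (h1 : m ∣ s - k * t) (h2 : m * N ∣ k ^ 2 + 3) (h3 : m * N ∣ a - k * b) :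
    ∃ a1 b1 : ℤ, a = s * a1 - 3 * t * b1 ∧ b = s * b1 + t * a1 ∧ N ∣ a1 - k * b1 := by
  obtain ⟨x, hx⟩ := h1
  obtain ⟨y, hy⟩ := h2
  obtain ⟨w, hw⟩ := h3
  have hb : b * s - a * t = m * (b * x - N * w * t) := by
    linear_combination b * hx - t * hw
  have ha : a * s + 3 * b * t = m * (N * w * s + k * b * x + b * t * N * y) := by
    linear_combination s * hw + k * b * hx + b * t * hy
  refine ⟨N * w * s + k * b * x + b * t * N * y, b * x - N * w * t, ?_, ?_,
    ⟨w * s + b * t * y + k * w * t, by ring⟩⟩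
  · apply mul_left_cancel₀ hm.ne'
    linear_combination a * hst + s * ha - 3 * t * hb
  · apply mul_left_cancel₀ hm.ne'
    linear_combination b * hst + s * hb + t * ha

lemma isCoprime_congr {a b c : ℤ} (h : IsCoprime a b) (e : b = c) : IsCoprime a c := e ▸ h

/-- Euler's lemma on cubes of the form `a ^ 2 + 3 b ^ 2`. -/
lemma cube_repr {a b m : ℤ} (hm : 0 < m) (hodd : Odd m) (hab : IsCoprime a b)
    (h : a ^ 2 + 3 * b ^ 2 = m ^ 3) :
    ∃ s t : ℤ, a = s * (s ^ 2 - 9 * t ^ 2) ∧ b = 3 * t * (s ^ 2 - t ^ 2) ∧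
      m = s ^ 2 + 3 * t ^ 2 := by
  have hbm : IsCoprime b (m ^ 3) := by
    rw [← h]
    have h1 : IsCoprime b (a ^ 2) := hab.symm.pow_right
    have h2 := h1.add_mul_left_right (3 * b)
    exact isCoprime_congr h2 (by ring)
  obtain ⟨x, y, hxy⟩ := id hbm
  set k := a * x with hk
  have h3 : m ^ 3 ∣ a - k * b := ⟨a * y, by rw [hk]; linear_combination (-a) * hxy⟩
  have h2 : m ^ 3 ∣ k ^ 2 + 3 := by
    have : m ^ 3 ∣ b ^ 2 * (k ^ 2 + 3) := by
      obtain ⟨w, hw⟩ := h3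
      exact ⟨1 - w * (a + k * b), by linear_combination h - (a + k * b) * hw⟩
    exact (hbm.symm.pow_right).dvd_of_dvd_mul_left this
  obtain ⟨s, t, hst, hd⟩ := form_repr (m.toNat + 1) m hm (by push_cast; omega) hodd k
    ((dvd_pow_self m (by norm_num)).trans h2)
  obtain ⟨a1, b1, e1, f1, g1⟩ := form_div (N := m ^ 2) hm hst hd
    (by convert h2 using 1; ring) (by convert h3 using 1; ring)
  obtain ⟨a2, b2, e2, f2, g2⟩ := form_div (N := m) hm hst hd
    ((show m * m ∣ m ^ 3 from ⟨m, by ring⟩).trans h2) (by convert g1 using 1; ring)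
  obtain ⟨a3, b3, e3, f3, g3⟩ := form_div (N := 1) hm hst hd
    ((show m * 1 ∣ m ^ 3 from ⟨m ^ 2, by ring⟩).trans h2) (by convert g2 using 1; ring)
  have hnorm : m ^ 3 * (a3 ^ 2 + 3 * b3 ^ 2) = m ^ 3 * 1 := by
    have e : m ^ 3 * (a3 ^ 2 + 3 * b3 ^ 2) = a ^ 2 + 3 * b ^ 2 := by
      rw [e1, f1, e2, f2, e3, f3, hst]; ring
    rw [e, h, mul_one]
  have h1 := mul_left_cancel₀ (by positivity) hnorm
  have hb3 : b3 = 0 := by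
    by_contra hne
    have : 0 < b3 ^ 2 := by positivity
    nlinarith [sq_nonneg a3]
  subst hb3
  have ha3 : a3 = 1 ∨ a3 = -1 := by
    have h1' : a3 ^ 2 = 1 := by linarith
    simpa using h1'
  rcases ha3 with rfl | rfl
  · exact ⟨s, t, by rw [e1, e2, f2, e3, f3]; ring, by rw [f1, e2, f2, e3, f3]; ring, hst⟩
  · exact ⟨-s, -t, by rw [e1, e2, f2, e3, f3]; ring, by rw [f1, e2, f2, e3, f3]; ring,
      by rw [hst]; ring⟩

/-- The statement of the descent. -/
def DescentAt (n : ℕ) : Prop := ∀ p q z : ℤ, z.natAbs = n → p * (p ^ 2 + 3 * q ^ 2) = z ^ 3 →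
  IsCoprime p q → Odd (p + q) → p = 0 ∨ q = 0

lemma descent_use {α β γ : ℤ} (H : DescentAt α.natAbs) (h : β ^ 3 + γ ^ 3 = 2 * α ^ 3)
    (hc : IsCoprime (β ^ 3) (γ ^ 3)) (hβ : Odd (β ^ 3)) (hγ : Odd (γ ^ 3)) :
    β = γ ∨ β = -γ := by
  have hc' : IsCoprime β γ := (IsCoprime.pow_iff (by norm_num) (by norm_num)).1 hc
  have hβ' : Odd β := by rw [Int.odd_pow] at hβ; simpa using hβ
  have hγ' : Odd γ := by rw [Int.odd_pow] at hγ; simpa using hγ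
  obtain ⟨j, rfl⟩ := hβ'
  obtain ⟨i, rfl⟩ := hγ'
  have := H (i + j + 1) (i - j) α rfl (by linarith) (by
    obtain ⟨x, y, hxy⟩ := hc'
    exact ⟨x + y, y - x, by linear_combination hxy⟩) ⟨i, by ring⟩
  omega

/-- Three pairwise coprime factors of a cube. -/
lemma three_cubes {a b c z : ℤ} (hab : IsCoprime a b) (hac : IsCoprime a c)
    (hbc : IsCoprime b c) (h : a * b * c = z ^ 3) :
    (∃ x, a = x ^ 3) ∧ (∃ x, b = x ^ 3) ∧ ∃ x, c = x ^ 3 := by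
  have o : Odd 3 := by decide
  refine ⟨?_, ?_, ?_⟩
  · exact Int.eq_pow_of_mul_eq_pow_odd_left (hab.mul_right hac) o (c := z) (by rw [← h]; ring)
  · exact Int.eq_pow_of_mul_eq_pow_odd_left (hab.symm.mul_right hbc) o (c := z)
      (by rw [← h]; ring)
  · exact Int.eq_pow_of_mul_eq_pow_odd_left (hac.symm.mul_right hbc.symm) o (c := z)
      (by rw [← h]; ring)

lemma natAbs_lt_of_cube {α z c m : ℤ} (hz : z ≠ 0) (hm : 1 < m) (h : z ^ 3 = (α * c * m) ^ 3) :
    α.natAbs < z.natAbs := by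
  have h' : z = α * c * m := (Odd.strictMono_pow (by decide : Odd 3)).injective h
  have hα : α ≠ 0 := by rintro rfl; simp at h'; exact hz h'
  have hc : c ≠ 0 := by rintro rfl; simp at h'; exact hz h'
  rw [h', Int.natAbs_mul, Int.natAbs_mul]
  have h1 : 0 < α.natAbs := Int.natAbs_pos.2 hα
  have h2 : 0 < c.natAbs := Int.natAbs_pos.2 hc
  have h3 : 1 < m.natAbs := by omega
  have h4 : α.natAbs ≤ α.natAbs * c.natAbs := Nat.le_mul_of_pos_right _ h2
  nlinarith

lemma isCoprime_two_of_odd {a : ℤ} (h : Odd a) : IsCoprime a 2 := by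
  obtain ⟨j, rfl⟩ := h
  exact ⟨1, -j, by ring⟩

lemma cube_pos_of_pos {m : ℤ} (h : 1 < m ^ 3) : 1 < m := by
  by_contra hm
  rcases le_or_gt m 0 with h0 | h0
  · have : m ^ 3 ≤ 0 := Odd.pow_nonpos (by decide) h0
    omega
  · have : m = 1 := by omega
    subst this; norm_num at h

lemma descent (n : ℕ) : DescentAt n := by
  induction n using Nat.strong_induction_on with
  | _ n ih =>
  intro p q z hz h hpq hodd
  by_contra hne
  push Not at hne
  obtain ⟨hp, hq⟩ := hne
  have hp2 : 0 < p ^ 2 := by positivity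
  have hq2 : 0 < q ^ 2 := by positivity
  have hz0 : z ≠ 0 := by
    rintro rfl
    have : p * (p ^ 2 + 3 * q ^ 2) ≠ 0 := mul_ne_zero hp (by positivity)
    exact this (by simpa using h)
  have o3 : Odd 3 := by decide
  by_cases h3 : (3 : ℤ) ∣ p
  · obtain ⟨r, rfl⟩ := h3
    have hr : r ≠ 0 := by rintro rfl; simp at hp
    have hr2 : 0 < r ^ 2 := by positivity
    have hrq : IsCoprime r q := hpq.of_mul_left_right
    have h3q : IsCoprime 3 q := hpq.of_mul_left_left
    have hodd' : Odd (q ^ 2 + 3 * r ^ 2) := by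
      obtain ⟨j, hj⟩ := hodd
      have : q = 2 * j + 1 - 3 * r := by linarith
      exact ⟨2 * j ^ 2 + 2 * j - 3 * r * (2 * j + 1) + 6 * r ^ 2, by rw [this]; ring⟩
    have c1 : IsCoprime (9 * (3 * r) / 3) (q ^ 2 + 3 * r ^ 2) := by
      have e : 9 * (3 * r) / 3 = 3 ^ 2 * r := by omega
      rw [e]
      apply IsCoprime.mul_left
      · apply IsCoprime.pow_left
        exact (h3q.pow_right (n := 2)).add_mul_left_right (r ^ 2)
      · have := (hrq.pow_right (n := 2)).add_mul_left_right (3 * r)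
        exact isCoprime_congr this (by ring)
    have e : 9 * (3 * r) / 3 = 9 * r := by omega
    rw [e] at c1
    obtain ⟨⟨g, hg⟩, m, hm⟩ := Int.eq_pow_of_mul_eq_pow_odd c1 o3 (c := z)
      (by rw [← h]; ring)
    have hm1 : 1 < m := cube_pos_of_pos (by rw [← hm]; nlinarith)
    have hmo : Odd m := by
      rw [hm, Int.odd_pow] at hodd'; simpa using hodd'
    obtain ⟨s, t, hs, ht, hst⟩ := cube_repr (by omega) hmo hrq.symm hm
    have hcst : IsCoprime s t := by
      rw [hs, ht] at hrq
      exact (hrq.of_mul_left_left.of_mul_left_right.of_mul_right_left).symm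
    have hsto : Odd (s + t) := by
      rw [hst] at hmo
      obtain ⟨j, hj⟩ := hmo
      rcases Int.even_or_odd (s + t) with ⟨i, hi⟩ | ho
      · exfalso
        have : s = 2 * i - t := by linarith
        rw [this] at hj
        ring_nf at hj
        omega
      · exact ho
    have hsto' : Odd (s - t) := by
      obtain ⟨j, hj⟩ := hsto; exact ⟨j - t, by linarith⟩
    have k1 : IsCoprime t (s - t) := by
      obtain ⟨x, y, hxy⟩ := hcst
      exact ⟨x + y, x, by linear_combination hxy⟩
    have k2 : IsCoprime t (s + t) := by
      obtain ⟨x, y, hxy⟩ := hcst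
      exact ⟨y - x, x, by linear_combination hxy⟩
    have k3 : IsCoprime (s - t) (s + t) := by
      have a1 : IsCoprime (s - t) (t * 2) :=
        k1.symm.mul_right (isCoprime_two_of_odd hsto')
      have := a1.add_mul_left_right 1
      exact isCoprime_congr this (by ring)
    have h3g : (3 : ℤ) ∣ g := by
      apply Int.prime_three.dvd_of_dvd_pow (n := 3)
      exact ⟨3 * r, by linarith⟩
    obtain ⟨g', rfl⟩ := h3g
    obtain ⟨⟨α, hα⟩, ⟨β, hβ⟩, γ, hγ⟩ := three_cubes (z := g') k1 k2 k3 (by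
      rw [ht] at hg; linarith)
    have hlt : α.natAbs < z.natAbs := by
      apply natAbs_lt_of_cube (c := 3 * β * γ) hz0 hm1
      have : z ^ 3 = 27 * (t * (s - t) * (s + t)) * (q ^ 2 + 3 * r ^ 2) := by
        rw [← h]
        linear_combination (9 * (q ^ 2 + 3 * r ^ 2)) * ht
      rw [this, hβ, hγ, hα, hm]
      ring
    have := descent_use (α := α) (β := -β) (γ := γ) (ih _ (hz ▸ hlt))
      (by rw [o3.neg_pow, ← hα, ← hβ, ← hγ]; ring)
      (by rw [o3.neg_pow, ← hβ, ← hγ]; exact k3.neg_left)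
      (by rw [o3.neg_pow, ← hβ]; exact hsto'.neg) (by rw [← hγ]; exact hsto)
    rcases this with h' | h'
    · rw [← h', o3.neg_pow, ← hβ] at hγ
      have : s = 0 := by linarith
      apply hq; rw [hs, this]; ring
    · have h'' : β = γ := by linarith
      rw [← h'', ← hβ] at hγ
      have : t = 0 := by linarith
      apply hr; rw [ht, this]; ring
  · have h3p : IsCoprime p 3 :=
      ((Int.prime_three.coprime_iff_not_dvd).2 h3).symm
    have hodd' : Odd (p ^ 2 + 3 * q ^ 2) := by
      obtain ⟨j, hj⟩ := hodd
      have : p = 2 * j + 1 - q := by linarith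
      exact ⟨2 * j ^ 2 + 2 * j - q * (2 * j + 1) + 2 * q ^ 2, by rw [this]; ring⟩
    have c1 : IsCoprime p (p ^ 2 + 3 * q ^ 2) := by
      have := (h3p.mul_right (hpq.pow_right (n := 2))).add_mul_left_right p
      exact isCoprime_congr this (by ring)
    obtain ⟨⟨g, hg⟩, m, hm⟩ := Int.eq_pow_of_mul_eq_pow_odd c1 o3 h
    have hm1 : 1 < m := cube_pos_of_pos (by rw [← hm]; nlinarith)
    have hmo : Odd m := by
      rw [hm, Int.odd_pow] at hodd'; simpa using hodd'
    obtain ⟨s, t, hs, ht, hst⟩ := cube_repr (by omega) hmo hpq hm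
    have hcst : IsCoprime s t := by
      rw [hs, ht] at hpq
      exact hpq.of_mul_left_left.of_mul_right_left.of_mul_right_right
    have hs3 : IsCoprime s 3 := by
      rw [hs] at h3p
      exact h3p.of_mul_left_left
    have hsto : Odd (s + 3 * t) := by
      rw [hst] at hmo
      obtain ⟨j, hj⟩ := hmo
      rcases Int.even_or_odd (s + 3 * t) with ⟨i, hi⟩ | ho
      · exfalso
        have : s = 2 * i - 3 * t := by linarith
        rw [this] at hj
        ring_nf at hj
        omega
      · exact ho
    have hsto' : Odd (s - 3 * t) := by
      obtain ⟨j, hj⟩ := hsto; exact ⟨j - 3 * t, by linarith⟩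
    have hs3t : IsCoprime s (3 * t) := hs3.mul_right hcst
    have k1 : IsCoprime s (s - 3 * t) := by
      obtain ⟨x, y, hxy⟩ := hs3t
      exact ⟨x + y, -y, by linear_combination hxy⟩
    have k2 : IsCoprime s (s + 3 * t) := by
      obtain ⟨x, y, hxy⟩ := hs3t
      exact ⟨x - y, y, by linear_combination hxy⟩
    have k3 : IsCoprime (s - 3 * t) (s + 3 * t) := by
      have a1 : IsCoprime (s - 3 * t) (s * 2) :=
        k1.symm.mul_right (isCoprime_two_of_odd hsto')
      have := a1.add_mul_left_right (-1)
      exact isCoprime_congr this (by ring)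
    obtain ⟨⟨α, hα⟩, ⟨β, hβ⟩, γ, hγ⟩ := three_cubes (z := g) k1 k2 k3 (by
      rw [← hg, hs]; ring)
    have hlt : α.natAbs < z.natAbs := by
      apply natAbs_lt_of_cube (c := β * γ) hz0 hm1
      have : z ^ 3 = (s * (s - 3 * t) * (s + 3 * t)) * (p ^ 2 + 3 * q ^ 2) := by
        rw [← h]
        linear_combination (p ^ 2 + 3 * q ^ 2) * hs
      rw [this, hβ, hγ, hα, hm]
      ring
    have := descent_use (α := α) (β := β) (γ := γ) (ih _ (hz ▸ hlt))
      (by rw [← hα, ← hβ, ← hγ]; ring)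
      (by rw [← hβ, ← hγ]; exact k3)
      (by rw [← hβ]; exact hsto') (by rw [← hγ]; exact hsto)
    rcases this with h' | h'
    · rw [← h', ← hβ] at hγ
      have : t = 0 := by linarith
      apply hq; rw [ht, this]; ring
    · rw [h', o3.neg_pow, ← hγ] at hβ
      have : s = 0 := by linarith
      apply hp; rw [hs, this]; ring

/-- There is no positive integer `d` such that `2d + 1`, `13d + 1` and `26d + 1` are
simultaneously perfect cubes. -/
theorem no_simultaneous_cubes :
    ¬ ∃ (d u v w : ℕ), 0 < d ∧ 0 < u ∧ 0 < v ∧ 0 < w ∧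
      2 * d + 1 = u ^ 3 ∧ 13 * d + 1 = v ^ 3 ∧ 26 * d + 1 = w ^ 3 := by
  rintro ⟨d, u, v, w, hd, -, -, -, -, hv, hw⟩
  have hv' : (13 * d + 1 : ℤ) = (v : ℤ) ^ 3 := by exact_mod_cast hv
  have hw' : (26 * d + 1 : ℤ) = (w : ℤ) ^ 3 := by exact_mod_cast hw
  have := descent_use (α := v) (β := 1) (γ := w) (descent _) (by linarith)
    (by rw [one_pow]; exact isCoprime_one_left) (by simp)
    ⟨13 * d, by linarith⟩
  rcases this with h | h
  · rw [← h] at hw'; omega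
  · omega
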